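/- arXiv:1105.4088 — 2 statements merged into one kernel-verified Lean document; each statement's English description precedes it below -/
import Mathlib

section
/- For every ĵ ∈ ℕ₀ and all real numbers 0 < r₁ < r₂ there exists a smooth function η̂ ∈ C^∞(ℝ, ℝ) with η̂(t) = 0 for all t ≤ r₁ and η̂(t) = 1 for all t ≥ r₂ (so that η̂′ is smooth with support contained in [r₁, r₂]), such that the moment conditions ∫_ℝ η̂′(r) r^j dr = δ_{0,j} hold for every integer j with -ĵ ≤ j ≤ ĵ; that is, ∫_ℝ η̂′(r) dr = 1 and ∫_ℝ η̂′(r) r^j dr = 0 for every integer j with 1 ≤ |j| ≤ ĵ. (The cutoff function with prescribed vanishing moments, property (2.6), used throughout the orthogonality computations.) -/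
open MeasureTheory

/-- A nonzero, nonnegative, compactly supported continuous weight on `ℝ` admits, for every
prescribed list of `N` moments, a polynomial density realising these moments. -/
theorem exists_polynomial_integral_mul_pow_eq {φ : ℝ → ℝ} (hφ : Continuous φ)
    (hc : HasCompactSupport φ) (h0 : ∀ x, 0 ≤ φ x) (hne : ∃ x, φ x ≠ 0)
    (N : ℕ) (m : Fin N → ℝ) :
    ∃ p : Polynomial ℝ, ∀ k : Fin N, ∫ x, φ x * (p.eval x * x ^ (k : ℕ)) = m k := by
  have hint (q : Polynomial ℝ) : Integrable (fun x => φ x * q.eval x) :=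
    (hφ.mul q.continuous).integrable_of_hasCompactSupport hc.mul_right
  let T : Polynomial ℝ →ₗ[ℝ] ℝ :=
    { toFun := fun q => ∫ x, φ x * q.eval x
      map_add' := fun p q => by
        simp only [Polynomial.eval_add, mul_add]
        exact integral_add (hint p) (hint q)
      map_smul' := fun c q => by
        simp only [Polynomial.eval_smul, smul_eq_mul, RingHom.id_apply, mul_left_comm _ c]
        exact integral_const_mul c _ }
  let L : Polynomial.degreeLT ℝ N →ₗ[ℝ] (Fin N → ℝ) :=
    LinearMap.pi fun k => T ∘ₗ LinearMap.mulRight ℝ (Polynomial.X ^ (k : ℕ)) ∘ₗ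
      (Polynomial.degreeLT ℝ N).subtype
  have hL (p : Polynomial.degreeLT ℝ N) (k : Fin N) :
      L p k = T (p.1 * Polynomial.X ^ (k : ℕ)) := rfl
  have hinj : Function.Injective L := by
    rw [injective_iff_map_eq_zero]
    rintro ⟨p, hp⟩ hp0
    have hT : T (p * p) = 0 := by
      have hsum : p * p = ∑ k ∈ p.support, p.coeff k • (p * Polynomial.X ^ k) := by
        conv_lhs => rw [p.as_sum_support_C_mul_X_pow, Finset.mul_sum]
        rw [← p.as_sum_support_C_mul_X_pow]
        refine Finset.sum_congr rfl fun k _ => ?_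
        rw [Polynomial.smul_eq_C_mul]
        ring
      rw [hsum, map_sum]
      refine Finset.sum_eq_zero fun k hk => ?_
      have hkN : k < N := by
        by_contra h
        rw [Polynomial.mem_degreeLT, Polynomial.degree_lt_iff_coeff_zero] at hp
        exact Polynomial.mem_support_iff.1 hk (hp k (not_lt.1 h))
      have := congrFun hp0 ⟨k, hkN⟩
      rw [hL] at this
      rw [map_smul, this, Pi.zero_apply, smul_zero]
    have hzero : (fun x => φ x * (p * p).eval x) = 0 := by
      by_contra h
      have hpos := (hφ.mul (p * p).continuous).integral_pos_of_hasCompactSupport_nonneg_nonzero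
        (μ := volume) hc.mul_right
        (fun x => mul_nonneg (h0 x) (by simpa using mul_self_nonneg (p.eval x)))
        (Function.ne_iff.1 h).choose_spec
      exact hpos.ne' hT
    obtain ⟨x₀, hx₀⟩ := hne
    have hinf : {x | φ x ≠ 0}.Infinite :=
      infinite_of_mem_nhds x₀ ((isOpen_ne_fun hφ continuous_const).mem_nhds hx₀)
    have hp : p = 0 := Polynomial.eq_zero_of_infinite_isRoot p <| hinf.mono fun x hx => by
      simpa [show φ x ≠ 0 from hx] using congrFun hzero x
    exact Subtype.ext hp
  have hfr : Module.finrank ℝ (Polynomial.degreeLT ℝ N) = Module.finrank ℝ (Fin N → ℝ) :=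
    (Polynomial.degreeLTEquiv ℝ N).finrank_eq
  have : FiniteDimensional ℝ (Polynomial.degreeLT ℝ N) :=
    (Polynomial.degreeLTEquiv ℝ N).symm.finiteDimensional
  obtain ⟨p, hp⟩ := (LinearMap.injective_iff_surjective_of_finrank_eq_finrank hfr).1 hinj m
  refine ⟨p, fun k => ?_⟩
  rw [← hp, hL]
  simp [T]

/-- Property (2.6): a cutoff function with prescribed vanishing moments. -/
theorem cutoff_with_vanishing_moments
    (jmax : ℕ) (r₁ r₂ : ℝ) (hr₁ : 0 < r₁) (hr₁₂ : r₁ < r₂) :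
    ∃ ηh : ℝ → ℝ, ContDiff ℝ (⊤ : ℕ∞) ηh ∧
      (∀ t : ℝ, t ≤ r₁ → ηh t = 0) ∧
      (∀ t : ℝ, r₂ ≤ t → ηh t = 1) ∧
      ∀ j : ℤ, -(jmax : ℤ) ≤ j → j ≤ (jmax : ℤ) →
        (∫ r : ℝ, deriv ηh r * r ^ j) = if j = 0 then 1 else 0 := by
  let φ : ContDiffBump ((r₁ + r₂) / 2) := ⟨(r₂ - r₁) / 4, (r₂ - r₁) / 2, by linarith, by linarith⟩
  have hsupp (x : ℝ) (hx : φ x ≠ 0) : r₁ < x ∧ x < r₂ := by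
    have hx' : x ∈ Metric.ball ((r₁ + r₂) / 2) ((r₂ - r₁) / 2) := by
      rw [← φ.support_eq]; exact hx
    rw [Real.ball_eq_Ioo] at hx'
    constructor <;> linarith [hx'.1, hx'.2]
  obtain ⟨p, hp⟩ := exists_polynomial_integral_mul_pow_eq φ.continuous φ.hasCompactSupport
    (fun _ => φ.nonneg) ⟨(r₁ + r₂) / 2, (φ.pos_of_mem_ball (Metric.mem_ball_self φ.rOut_pos)).ne'⟩
    (2 * jmax + 1) (fun k => if (k : ℕ) = jmax then 1 else 0)
  let g : ℝ → ℝ := fun x => φ x * (x ^ jmax * p.eval x)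
  have hg : ContDiff ℝ (⊤ : ℕ∞) g :=
    φ.contDiff.mul ((contDiff_id.pow jmax).mul (by simpa using p.contDiff_aeval (𝕜 := ℝ) _))
  have hgz (x : ℝ) (hx : ¬ (r₁ < x ∧ x < r₂)) : g x = 0 := by
    have : φ x = 0 := by_contra fun h => hx (hsupp x h)
    simp [g, this]
  have hmom (j : ℤ) (h₁ : -(jmax : ℤ) ≤ j) (h₂ : j ≤ (jmax : ℤ)) :
      (∫ r : ℝ, g r * r ^ j) = if j = 0 then 1 else 0 := by
    obtain ⟨k, hk⟩ := Int.eq_ofNat_of_zero_le (show 0 ≤ j + jmax by omega)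
    have hpk := hp ⟨k, by omega⟩
    have hiff : k = jmax ↔ j = 0 := by omega
    simp only [hiff] at hpk
    rw [← hpk]
    refine integral_congr_ae (Filter.Eventually.of_forall fun x => ?_)
    by_cases hx : φ x = 0
    · simp [g, hx]
    · have hx0 : x ≠ 0 := (hr₁.trans (hsupp x hx).1).ne'
      have hpow : x ^ k = x ^ j * x ^ jmax := by
        rw [← zpow_natCast x k, ← zpow_natCast x jmax, ← zpow_add₀ hx0, hk]
      simp only [g, hpow]
      ring
  have hderiv (t : ℝ) : HasDerivAt (fun t => ∫ x in r₁..t, g x) (g t) t :=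
    hg.continuous.integral_hasStrictDerivAt r₁ t |>.hasDerivAt
  have hderiv_eq : deriv (fun t => ∫ x in r₁..t, g x) = g := funext fun t => (hderiv t).deriv
  refine ⟨fun t => ∫ x in r₁..t, g x, ?_, fun t ht => ?_, fun t ht => ?_, ?_⟩
  · rw [contDiff_infty_iff_deriv, hderiv_eq]
    exact ⟨fun t => (hderiv t).differentiableAt, hg⟩
  · refine intervalIntegral.integral_zero_ae (Filter.Eventually.of_forall fun x hx => hgz x ?_)
    rw [Set.uIoc_of_ge ht] at hx
    exact fun h => h.1.not_ge hx.2
  · have hone : ∫ x, g x = 1 := by simpa using hmom 0 (by omega) (by omega)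
    rw [← hone]
    refine intervalIntegral.integral_eq_integral_of_support_subset fun x hx => ?_
    have := not_imp_comm.1 (hgz x) hx
    exact ⟨this.1, this.2.le.trans ht⟩
  · rw [hderiv_eq]
    exact hmom
end

section
/- Let N ≥ 3 be an odd natural number, let J ∈ ℕ (J ≥ 1), and let s, t ∈ ℝ satisfy s > J - 1/2 and t < min{s, N/2} - J - 1. Then there exists a constant C > 0 such that for every measurable function f : ℝ^N → ℂ with ∫_{ℝ^N} (1+|y|²)^s |f(y)|² dy < ∞, the integral (Tf)(x) = ∫_{ℝ^N} |x-y|^{J+1-N} f(y) dy converges absolutely for almost every x ∈ ℝ^N and satisfies ∫_{ℝ^N} (1+|x|²)^t |(Tf)(x)|² dx ≤ C² · ∫_{ℝ^N} (1+|y|²)^s |f(y)|² dy. In other words, the integral operator with kernel |x-y|^{J+1-N} is a bounded linear operator from L²_s(ℝ^N) to L²_t(ℝ^N). (The kernel boundedness established in the proof of Lemma 3.15, which controls all remainder and expansion terms of the whole-space low frequency asymptotics.) -/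
open MeasureTheory
open scoped ENNReal NNReal

/-- The square of an `ℝ≥0∞`-valued integral of a product is bounded by the product of the
integrals of the squares. -/
theorem lintegral_mul_sq_le {X : Type*} [MeasurableSpace X] (μ : Measure X) {f g : X → ℝ≥0∞}
    (hf : AEMeasurable f μ) (hg : AEMeasurable g μ) :
    (∫⁻ x, f x * g x ∂μ) ^ 2 ≤ (∫⁻ x, f x ^ 2 ∂μ) * ∫⁻ x, g x ^ 2 ∂μ := by
  have h := ENNReal.lintegral_mul_le_Lp_mul_Lq μ Real.HolderConjugate.two_two hf hg
  simp only [Pi.mul_apply, ENNReal.rpow_two] at h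
  refine (pow_le_pow_left' h 2).trans_eq ?_
  rw [mul_pow, ← ENNReal.rpow_two, ← ENNReal.rpow_mul, ← ENNReal.rpow_two, ← ENNReal.rpow_mul]
  norm_num

/-- The integral operator with the nonnegative kernel `k` is bounded on `L²`. -/
def IsL2BoundedKernel {X : Type*} [MeasurableSpace X] (μ : Measure X) (k : X → X → ℝ≥0∞) : Prop :=
  ∃ C : ℝ≥0, ∀ g : X → ℝ≥0∞, Measurable g →
    ∫⁻ x, (∫⁻ y, k x y * g y ∂μ) ^ 2 ∂μ ≤ C * ∫⁻ y, g y ^ 2 ∂μ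

namespace IsL2BoundedKernel

variable {X : Type*} [MeasurableSpace X] {μ : Measure X} {k l : X → X → ℝ≥0∞}

theorem of_le_const_mul (hl : IsL2BoundedKernel μ l) (c : ℝ≥0) (h : ∀ x y, k x y ≤ c * l x y) :
    IsL2BoundedKernel μ k := by
  obtain ⟨C, hC⟩ := hl
  refine ⟨c ^ 2 * C, fun g hg => ?_⟩
  calc ∫⁻ x, (∫⁻ y, k x y * g y ∂μ) ^ 2 ∂μ
      ≤ ∫⁻ x, (∫⁻ y, c * (l x y * g y) ∂μ) ^ 2 ∂μ := by
        refine lintegral_mono fun x => pow_le_pow_left' (lintegral_mono fun y => ?_) 2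
        rw [← mul_assoc]
        exact mul_le_mul_left (h x y) _
    _ = c ^ 2 * ∫⁻ x, (∫⁻ y, l x y * g y ∂μ) ^ 2 ∂μ := by
        simp only [lintegral_const_mul' _ _ ENNReal.coe_ne_top, mul_pow]
        exact lintegral_const_mul' _ _ (by simp)
    _ ≤ c ^ 2 * (C * ∫⁻ y, g y ^ 2 ∂μ) := by
        gcongr
        exact hC g hg
    _ = _ := by push_cast; ring

theorem add [SFinite μ] (hk : IsL2BoundedKernel μ k) (hl : IsL2BoundedKernel μ l)
    (hkm : Measurable k.uncurry) : IsL2BoundedKernel μ (fun x y => k x y + l x y) := by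
  obtain ⟨C, hC⟩ := hk
  obtain ⟨D, hD⟩ := hl
  refine ⟨2 * (C + D), fun g hg => ?_⟩
  have hm : Measurable fun x => ∫⁻ y, k x y * g y ∂μ :=
    Measurable.lintegral_prod_right' (f := fun p : X × X => k p.1 p.2 * g p.2)
      (hkm.mul (hg.comp measurable_snd))
  calc ∫⁻ x, (∫⁻ y, (k x y + l x y) * g y ∂μ) ^ 2 ∂μ
      ≤ ∫⁻ x, 2 * ((∫⁻ y, k x y * g y ∂μ) ^ 2 + (∫⁻ y, l x y * g y ∂μ) ^ 2) ∂μ := by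
        gcongr with x
        have hx : Measurable fun y => k x y * g y :=
          (hkm.comp measurable_prodMk_left).mul hg
        simp only [add_mul]
        rw [lintegral_add_left hx]
        have := ENNReal.rpow_add_le_mul_rpow_add_rpow (∫⁻ y, k x y * g y ∂μ)
          (∫⁻ y, l x y * g y ∂μ) (p := 2) (by norm_num)
        norm_num at this
        exact this
    _ = 2 * (∫⁻ x, (∫⁻ y, k x y * g y ∂μ) ^ 2 ∂μ + ∫⁻ x, (∫⁻ y, l x y * g y ∂μ) ^ 2 ∂μ) := by
        rw [lintegral_const_mul' _ _ (by norm_num), lintegral_add_left (hm.pow_const 2)]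
    _ ≤ 2 * (C * ∫⁻ y, g y ^ 2 ∂μ + D * ∫⁻ y, g y ^ 2 ∂μ) := by
        gcongr
        · exact hC g hg
        · exact hD g hg
    _ = _ := by push_cast; ring

/-- **Schur test** with constant weights. -/
theorem of_lintegral_le [SFinite μ] (hkm : Measurable k.uncurry) (A B : ℝ≥0)
    (hA : ∀ x, ∫⁻ y, k x y ∂μ ≤ A) (hB : ∀ y, ∫⁻ x, k x y ∂μ ≤ B) :
    IsL2BoundedKernel μ k := by
  refine ⟨A * B, fun g hg => ?_⟩
  have hsq : ∀ a : ℝ≥0∞, (a ^ (1 / 2 : ℝ)) ^ 2 = a := fun a => by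
    rw [← ENNReal.rpow_two, ← ENNReal.rpow_mul]; norm_num
  have hpt : ∀ x, (∫⁻ y, k x y * g y ∂μ) ^ 2 ≤ A * ∫⁻ y, k x y * g y ^ 2 ∂μ := by
    intro x
    have hx : Measurable fun y => k x y := hkm.comp measurable_prodMk_left
    have h := lintegral_mul_sq_le μ (f := fun y => k x y ^ (1 / 2 : ℝ))
      (g := fun y => k x y ^ (1 / 2 : ℝ) * g y) (hx.pow_const _).aemeasurable
      ((hx.pow_const _).mul hg).aemeasurable
    simp only [← mul_assoc, mul_pow, hsq, ← sq] at h
    exact h.trans (mul_le_mul_left (hA x) _)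
  calc ∫⁻ x, (∫⁻ y, k x y * g y ∂μ) ^ 2 ∂μ
      ≤ ∫⁻ x, A * ∫⁻ y, k x y * g y ^ 2 ∂μ ∂μ := lintegral_mono hpt
    _ = A * ∫⁻ y, ∫⁻ x, k x y * g y ^ 2 ∂μ ∂μ := by
        rw [lintegral_const_mul' _ _ (by simp), lintegral_lintegral_swap]
        exact (hkm.mul ((hg.comp measurable_snd).pow_const 2)).aemeasurable
    _ ≤ A * ∫⁻ y, B * g y ^ 2 ∂μ := by
        gcongr with y
        have hy : Measurable fun x => k x y := hkm.comp measurable_prodMk_right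
        rw [lintegral_mul_const _ hy]
        gcongr
        exact hB y
    _ = _ := by
        rw [lintegral_const_mul _ (hg.pow_const 2)]; push_cast; ring

theorem rankOne {p q : X → ℝ≥0∞} (hp : Measurable p) (hq : Measurable q)
    (hp2 : ∫⁻ x, p x ^ 2 ∂μ ≠ ∞) (hq2 : ∫⁻ x, q x ^ 2 ∂μ ≠ ∞) :
    IsL2BoundedKernel μ (fun x y => p x * q y) := by
  lift ∫⁻ x, p x ^ 2 ∂μ to ℝ≥0 using hp2 with P hP
  lift ∫⁻ x, q x ^ 2 ∂μ to ℝ≥0 using hq2 with Q hQ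
  refine ⟨P * Q, fun g hg => ?_⟩
  have h (x : X) : ∫⁻ y, p x * q y * g y ∂μ = p x * ∫⁻ y, q y * g y ∂μ := by
    simp only [mul_assoc]
    exact lintegral_const_mul _ (hq.mul hg)
  simp only [h, mul_pow]
  rw [lintegral_mul_const _ (hp.pow_const 2), ← hP, ENNReal.coe_mul, mul_assoc, hQ]
  gcongr
  exact lintegral_mul_sq_le μ hq.aemeasurable hg.aemeasurable

end IsL2BoundedKernel

section RieszPotential

open Module

variable {E : Type*} [NormedAddCommGroup E]

/-- The Japanese bracket `⟨x⟩ = √(1 + ‖x‖²)`. -/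
noncomputable def japaneseBracket (x : E) : ℝ := √(1 + ‖x‖ ^ 2)

local notation "⟪" x "⟫" => japaneseBracket x

theorem one_le_japaneseBracket (x : E) : 1 ≤ ⟪x⟫ :=
  Real.one_le_sqrt.2 (by nlinarith [norm_nonneg x])

theorem japaneseBracket_pos (x : E) : 0 < ⟪x⟫ :=
  one_pos.trans_le (one_le_japaneseBracket x)

theorem japaneseBracket_sq (x : E) : ⟪x⟫ ^ 2 = 1 + ‖x‖ ^ 2 :=
  Real.sq_sqrt (by positivity)

theorem japaneseBracket_rpow_sq (x : E) (r : ℝ) : (⟪x⟫ ^ r) ^ 2 = (1 + ‖x‖ ^ 2) ^ r := by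
  rw [← japaneseBracket_sq, ← Real.rpow_natCast, ← Real.rpow_natCast,
    ← Real.rpow_mul (japaneseBracket_pos x).le, ← Real.rpow_mul (japaneseBracket_pos x).le,
    mul_comm]

@[fun_prop]
theorem measurable_japaneseBracket [MeasurableSpace E] [BorelSpace E] :
    Measurable (japaneseBracket : E → ℝ) := by
  unfold japaneseBracket
  fun_prop

theorem norm_le_japaneseBracket (x : E) : ‖x‖ ≤ ⟪x⟫ :=
  Real.le_sqrt_of_sq_le (by linarith)

theorem japaneseBracket_le_add_norm_sub (x y : E) : ⟪x⟫ ≤ ⟪y⟫ + ‖x - y‖ := by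
  have h : ‖x‖ ≤ ‖y‖ + ‖x - y‖ := by
    simpa using norm_add_le y (x - y)
  refine Real.sqrt_le_iff.2 ⟨by have := japaneseBracket_pos y; positivity, ?_⟩
  nlinarith [japaneseBracket_sq y, norm_le_japaneseBracket y, norm_nonneg (x - y), norm_nonneg x,
    norm_nonneg y, mul_le_mul_of_nonneg_right (norm_le_japaneseBracket y) (norm_nonneg (x - y))]

theorem norm_sub_le_japaneseBracket_mul (x y : E) : ‖x - y‖ ≤ ⟪x⟫ * ⟪y⟫ := by
  rw [japaneseBracket, japaneseBracket, ← Real.sqrt_mul (by positivity)]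
  refine Real.le_sqrt_of_sq_le ?_
  nlinarith [pow_le_pow_left₀ (norm_nonneg _) (norm_sub_le x y) 2, sq_nonneg (‖x‖ * ‖y‖ - 1)]

/-- Off the diagonal, `‖x - y‖ ^ γ` is dominated by a product of powers of the brackets. -/
theorem norm_sub_rpow_le_of_half_le {x y : E} (h : ⟪x⟫ / 2 ≤ ‖x - y‖) {γ u v : ℝ}
    (huv : (γ ≤ 0 ∧ 0 ≤ u ∧ 0 ≤ v ∧ u + v = -γ) ∨ (0 < γ ∧ u = -γ ∧ v = -γ)) :
    ‖x - y‖ ^ γ ≤ 3 ^ |γ| * (⟪x⟫ ^ (-u) * ⟪y⟫ ^ (-v)) := by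
  have hx := japaneseBracket_pos x
  have hy := japaneseBracket_pos y
  have hd : 0 < ‖x - y‖ := by linarith
  rcases huv with ⟨hγ, hu, hv, huv⟩ | ⟨hγ, rfl, rfl⟩
  · have hyx := japaneseBracket_le_add_norm_sub y x
    rw [norm_sub_rev] at hyx
    have hu' : ‖x - y‖ ^ (-u) ≤ (⟪x⟫ / 3) ^ (-u) :=
      Real.rpow_le_rpow_of_nonpos (by positivity) (by linarith) (by linarith)
    have hv' : ‖x - y‖ ^ (-v) ≤ (⟪y⟫ / 3) ^ (-v) :=
      Real.rpow_le_rpow_of_nonpos (by positivity) (by linarith) (by linarith)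
    have hγ' : γ = -u + -v := by linarith
    calc ‖x - y‖ ^ γ = ‖x - y‖ ^ (-u) * ‖x - y‖ ^ (-v) := by rw [hγ', Real.rpow_add hd]
      _ ≤ (⟪x⟫ / 3) ^ (-u) * (⟪y⟫ / 3) ^ (-v) := by gcongr
      _ = 3 ^ |γ| * (⟪x⟫ ^ (-u) * ⟪y⟫ ^ (-v)) := by
        rw [abs_of_nonpos hγ, ← huv, Real.rpow_add (by norm_num), Real.div_rpow hx.le (by norm_num),
          Real.div_rpow hy.le (by norm_num), Real.rpow_neg (by norm_num : (0 : ℝ) ≤ 3),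
          Real.rpow_neg (by norm_num : (0 : ℝ) ≤ 3), div_inv_eq_mul, div_inv_eq_mul]
        ring
  · rw [neg_neg, ← Real.mul_rpow hx.le hy.le]
    calc ‖x - y‖ ^ γ ≤ (⟪x⟫ * ⟪y⟫) ^ γ := by
          gcongr
          exact norm_sub_le_japaneseBracket_mul x y
      _ ≤ _ := le_mul_of_one_le_left (by positivity)
          (Real.one_le_rpow (by norm_num) (abs_nonneg γ))

theorem japaneseBracket_rpow_mul_le_of_lt_half {x y : E} (h : ‖x - y‖ < ⟪x⟫ / 2) {α s t : ℝ}
    (hα : 0 ≤ α) (hst : t + α ≤ s) :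
    ⟪x⟫ ^ t * ⟪y⟫ ^ (-s) ≤ 2 ^ |s| * (⟪x⟫ / 2) ^ (-α) := by
  have hx := japaneseBracket_pos x
  have hy := japaneseBracket_pos y
  have hxy := japaneseBracket_le_add_norm_sub x y
  have hyx := japaneseBracket_le_add_norm_sub y x
  rw [norm_sub_rev] at hyx
  have hys : ⟪y⟫ ^ (-s) ≤ 2 ^ |s| * ⟪x⟫ ^ (-s) := by
    rcases le_total 0 s with hs | hs
    · calc ⟪y⟫ ^ (-s) ≤ (⟪x⟫ / 2) ^ (-s) :=
            Real.rpow_le_rpow_of_nonpos (by positivity) (by linarith) (by linarith)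
        _ = _ := by
          rw [abs_of_nonneg hs, Real.div_rpow hx.le (by norm_num),
            Real.rpow_neg (by norm_num : (0 : ℝ) ≤ 2), div_inv_eq_mul, mul_comm]
    · calc ⟪y⟫ ^ (-s) ≤ (2 * ⟪x⟫) ^ (-s) :=
            Real.rpow_le_rpow (by positivity) (by linarith) (by linarith)
        _ = _ := by rw [abs_of_nonpos hs, Real.mul_rpow (by norm_num) hx.le]
  calc ⟪x⟫ ^ t * ⟪y⟫ ^ (-s) ≤ ⟪x⟫ ^ t * (2 ^ |s| * ⟪x⟫ ^ (-s)) := by gcongr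
    _ = 2 ^ |s| * ⟪x⟫ ^ (t - s) := by rw [sub_eq_add_neg, Real.rpow_add hx]; ring
    _ ≤ 2 ^ |s| * ⟪x⟫ ^ (-α) := by
        gcongr
        · exact one_le_japaneseBracket x
        · linarith
    _ ≤ 2 ^ |s| * (⟪x⟫ / 2) ^ (-α) := by
        gcongr 2 ^ |s| * ?_
        exact Real.rpow_le_rpow_of_nonpos (by positivity) (by linarith) (by linarith)

/-- The exponent split used for the off-diagonal part of the weighted Riesz kernel. -/
theorem exists_riesz_exponent_split {d α s t : ℝ} (hs : α - d / 2 < s)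
    (ht : t < min s (d / 2) - α) :
    ∃ u v : ℝ, ((α - d ≤ 0 ∧ 0 ≤ u ∧ 0 ≤ v ∧ u + v = -(α - d)) ∨
      (0 < α - d ∧ u = -(α - d) ∧ v = -(α - d))) ∧ t - u < -(d / 2) ∧ -s - v < -(d / 2) := by
  have h1 : t < s - α := ht.trans_le (by gcongr; exact min_le_left _ _)
  have h2 : t < d / 2 - α := ht.trans_le (by gcongr; exact min_le_right _ _)
  rcases le_or_gt (α - d) 0 with h | h
  · rcases lt_or_ge (d / 2 + t) 0 with h3 | h3
    · exact ⟨0, d - α, .inl ⟨h, le_rfl, by linarith, by ring⟩, by linarith, by linarith⟩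
    rcases lt_or_ge (d / 2) s with h4 | h4
    · exact ⟨d - α, 0, .inl ⟨h, by linarith, le_rfl, by ring⟩, by linarith, by linarith⟩
    exact ⟨(t + d - α + s) / 2, d - α - (t + d - α + s) / 2,
      .inl ⟨h, by linarith, by linarith, by ring⟩, by linarith, by linarith⟩
  · exact ⟨-(α - d), -(α - d), .inr ⟨h, rfl, rfl⟩, by linarith, by linarith⟩

variable [NormedSpace ℝ E]

/-- The truncated Riesz kernel of order `α` at scale `R`, normalised so that its integral does not
depend on `R`. -/
noncomputable def truncatedRiesz (E : Type*) [NormedAddCommGroup E] [NormedSpace ℝ E]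
    (α R : ℝ) (z : E) : ℝ≥0∞ :=
  (Metric.ball (0 : E) R).indicator
    (fun z => ENNReal.ofReal (R ^ (-α) * ‖z‖ ^ (α - finrank ℝ E))) z

theorem truncatedRiesz_eq_ite (α R : ℝ) (z : E) :
    truncatedRiesz E α R z =
      if ‖z‖ < R then ENNReal.ofReal (R ^ (-α) * ‖z‖ ^ (α - finrank ℝ E)) else 0 := by
  by_cases h : ‖z‖ < R <;> simp [truncatedRiesz, h]

variable [MeasurableSpace E] [BorelSpace E]

theorem measurable_truncatedRiesz (α R : ℝ) : Measurable (truncatedRiesz E α R) := by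
  unfold truncatedRiesz
  exact Measurable.indicator (by fun_prop) measurableSet_ball

theorem lintegral_truncatedRiesz [FiniteDimensional ℝ E] (μ : Measure E) [μ.IsAddHaarMeasure] (α : ℝ) {R : ℝ}
    (hR : 0 < R) :
    ∫⁻ z, truncatedRiesz E α R z ∂μ = ∫⁻ z, truncatedRiesz E α 1 z ∂μ := by
  have h1 : ∀ z, truncatedRiesz E α 1 z =
      ENNReal.ofReal (R ^ finrank ℝ E) * truncatedRiesz E α R (R • z) := by
    intro z
    have hmem : R • z ∈ Metric.ball (0 : E) R ↔ z ∈ Metric.ball (0 : E) 1 := by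
      simp only [mem_ball_zero_iff, norm_smul, Real.norm_of_nonneg hR.le]
      exact mul_lt_iff_lt_one_right hR
    by_cases hz : z ∈ Metric.ball (0 : E) 1
    · rw [truncatedRiesz, truncatedRiesz, Set.indicator_of_mem hz,
        Set.indicator_of_mem (hmem.2 hz), ← ENNReal.ofReal_mul (by positivity), norm_smul,
        Real.norm_of_nonneg hR.le, Real.mul_rpow hR.le (norm_nonneg z), ← mul_assoc, ← mul_assoc,
        ← Real.rpow_natCast, ← Real.rpow_add hR, ← Real.rpow_add hR]
      simp [show (finrank ℝ E : ℝ) + -α + (α - finrank ℝ E) = 0 by ring]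
    · rw [truncatedRiesz, truncatedRiesz, Set.indicator_of_notMem hz,
        Set.indicator_of_notMem (hmem.not.2 hz), mul_zero]
  have hmap := Measure.map_addHaar_smul μ hR.ne'
  simp only [h1]
  have hm := measurable_truncatedRiesz (E := E) α R
  rw [lintegral_const_mul' _ _ (by simp), ← lintegral_map (g := fun z => R • z) hm (by fun_prop),
    hmap, lintegral_smul_measure, smul_eq_mul, ← mul_assoc, ← ENNReal.ofReal_mul (by positivity),
    abs_of_pos (by positivity), mul_inv_cancel₀ (by positivity)]
  simp

theorem lintegral_truncatedRiesz_one_ne_top [FiniteDimensional ℝ E] [Nontrivial E]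
    (μ : Measure E) [μ.IsAddHaarMeasure] {α : ℝ} (hα : 0 < α) : ∫⁻ z, truncatedRiesz E α 1 z ∂μ ≠ ∞ := by
  have h : IntegrableOn (fun z : E => (1 : ℝ) ^ (-α) * ‖z‖ ^ (α - finrank ℝ E))
      (Metric.ball 0 1) μ := by
    refine integrableOn_ball_of_norm_le_rpow (C := 1) (α := finrank ℝ E - α) (r := 1)
      finrank_pos (by linarith) ?_ ?_
    · refine Filter.Eventually.of_forall fun z => ?_
      simp [Real.norm_of_nonneg (Real.rpow_nonneg (norm_nonneg z) _)]
    · exact Measurable.aestronglyMeasurable (by fun_prop)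
  unfold truncatedRiesz
  rw [lintegral_indicator measurableSet_ball]
  exact h.lintegral_lt_top.ne

theorem lintegral_japaneseBracket_rpow_sq_ne_top [FiniteDimensional ℝ E] (μ : Measure E)
    [μ.IsAddHaarMeasure] {r : ℝ} (hr : r < -(finrank ℝ E / 2)) :
    ∫⁻ x : E, ENNReal.ofReal (⟪x⟫ ^ r) ^ 2 ∂μ ≠ ∞ := by
  have h := integrable_rpow_neg_one_add_norm_sq (E := E) (μ := μ) (r := -2 * r) (by linarith)
  convert h.lintegral_lt_top.ne using 4 with x
  rw [← ENNReal.ofReal_pow (Real.rpow_nonneg (japaneseBracket_pos x).le r),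
    japaneseBracket_rpow_sq]
  congr 2
  ring

theorem isL2BoundedKernel_truncatedRiesz [FiniteDimensional ℝ E] [Nontrivial E] (μ : Measure E)
    [μ.IsAddHaarMeasure] {α : ℝ} (hα : 0 < α) :
    IsL2BoundedKernel μ (fun x y => truncatedRiesz E α (⟪x⟫ / 2) (x - y)) := by
  have hfin := lintegral_truncatedRiesz_one_ne_top μ hα
  lift ∫⁻ z, truncatedRiesz E α 1 z ∂μ to ℝ≥0 using hfin with I hI
  have hcol : ∀ x y, truncatedRiesz E α (⟪x⟫ / 2) (x - y) ≤
      ENNReal.ofReal (4 ^ α) * truncatedRiesz E α ⟪y⟫ (x - y) := by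
    intro x y
    rw [truncatedRiesz_eq_ite, truncatedRiesz_eq_ite]
    have hx := japaneseBracket_pos x
    have hy := japaneseBracket_pos y
    have hxy := japaneseBracket_le_add_norm_sub x y
    have hyx := japaneseBracket_le_add_norm_sub y x
    rw [norm_sub_rev] at hyx
    split_ifs with h1 h2 h2
    · rw [← ENNReal.ofReal_mul (by positivity), ← mul_assoc]
      gcongr
      have h4 : (⟪y⟫ / 4) ^ (-α) = 4 ^ α * ⟪y⟫ ^ (-α) := by
        rw [Real.div_rpow hy.le (by norm_num), Real.rpow_neg (by norm_num : (0 : ℝ) ≤ 4),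
          div_inv_eq_mul, mul_comm]
      rw [← h4]
      exact Real.rpow_le_rpow_of_nonpos (by positivity) (by linarith) (by linarith)
    · exact absurd (by linarith) h2
    · exact zero_le
    · exact zero_le
  refine IsL2BoundedKernel.of_lintegral_le ?_ I (Real.toNNReal (4 ^ α) * I) (fun x => ?_)
    (fun y => ?_)
  · simp only [truncatedRiesz_eq_ite]
    refine Measurable.ite (measurableSet_lt (by fun_prop) (by fun_prop)) (by fun_prop)
      measurable_const
  · rw [lintegral_sub_left_eq_self (fun z => truncatedRiesz E α (⟪x⟫ / 2) z) x,
      lintegral_truncatedRiesz μ α (half_pos (japaneseBracket_pos x)), hI]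
  · calc ∫⁻ x, truncatedRiesz E α (⟪x⟫ / 2) (x - y) ∂μ
        ≤ ∫⁻ x, ENNReal.ofReal (4 ^ α) * truncatedRiesz E α ⟪y⟫ (x - y) ∂μ :=
          lintegral_mono fun x => hcol x y
      _ = _ := by
          rw [lintegral_const_mul' _ _ (by simp),
            lintegral_sub_right_eq_self (fun z => truncatedRiesz E α ⟪y⟫ z) y,
            lintegral_truncatedRiesz μ α (japaneseBracket_pos y), ← hI]
          simp [ENNReal.ofReal]

/-- The Riesz kernel of order `α` is bounded from `L²_s` to `L²_t`. -/
theorem isL2BoundedKernel_weighted_riesz [FiniteDimensional ℝ E] [Nontrivial E] (μ : Measure E)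
    [μ.IsAddHaarMeasure] {α s t : ℝ} (hα : 0 < α) (hs : α - (finrank ℝ E : ℝ) / 2 < s)
    (ht : t < min s ((finrank ℝ E : ℝ) / 2) - α) :
    IsL2BoundedKernel μ (fun x y =>
      ENNReal.ofReal (⟪x⟫ ^ t * ‖x - y‖ ^ (α - finrank ℝ E) * ⟪y⟫ ^ (-s))) := by
  obtain ⟨u, v, huv, hu, hv⟩ := exists_riesz_exponent_split hs ht
  have hst : t + α ≤ s := by linarith [min_le_left s ((finrank ℝ E : ℝ) / 2)]
  have hfar : IsL2BoundedKernel μ (fun x y : E =>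
      ENNReal.ofReal (⟪x⟫ ^ (t - u)) * ENNReal.ofReal (⟪y⟫ ^ (-s - v))) :=
    .rankOne (by fun_prop) (by fun_prop) (lintegral_japaneseBracket_rpow_sq_ne_top μ hu)
      (lintegral_japaneseBracket_rpow_sq_ne_top μ hv)
  set γ : ℝ := α - finrank ℝ E
  refine (hfar.add (isL2BoundedKernel_truncatedRiesz μ hα) ?_).of_le_const_mul
    (Real.toNNReal (3 ^ |γ| + 2 ^ |s|)) fun x y => ?_
  · unfold Function.uncurry
    fun_prop
  have hx := japaneseBracket_pos x
  have hy := japaneseBracket_pos y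
  change _ ≤ ENNReal.ofReal _ * _
  rcases lt_or_ge ‖x - y‖ (⟪x⟫ / 2) with h | h
  · refine le_trans ?_ (mul_le_mul_right le_add_self _)
    rw [truncatedRiesz_eq_ite, if_pos h, ← ENNReal.ofReal_mul (by positivity)]
    gcongr ENNReal.ofReal ?_
    calc ⟪x⟫ ^ t * ‖x - y‖ ^ γ * ⟪y⟫ ^ (-s) = ⟪x⟫ ^ t * ⟪y⟫ ^ (-s) * ‖x - y‖ ^ γ := by ring
      _ ≤ 2 ^ |s| * (⟪x⟫ / 2) ^ (-α) * ‖x - y‖ ^ γ := by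
        gcongr ?_ * _
        exact japaneseBracket_rpow_mul_le_of_lt_half h hα.le hst
      _ ≤ (3 ^ |γ| + 2 ^ |s|) * ((⟪x⟫ / 2) ^ (-α) * ‖x - y‖ ^ γ) := by
        rw [mul_assoc]
        gcongr
        exact le_add_of_nonneg_left (by positivity)
  · refine le_trans ?_ (mul_le_mul_right le_self_add _)
    rw [← ENNReal.ofReal_mul (by positivity), ← ENNReal.ofReal_mul (by positivity)]
    gcongr ENNReal.ofReal ?_
    calc ⟪x⟫ ^ t * ‖x - y‖ ^ γ * ⟪y⟫ ^ (-s)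
        ≤ ⟪x⟫ ^ t * (3 ^ |γ| * (⟪x⟫ ^ (-u) * ⟪y⟫ ^ (-v))) * ⟪y⟫ ^ (-s) := by
          gcongr
          exact norm_sub_rpow_le_of_half_le h huv
      _ = 3 ^ |γ| * (⟪x⟫ ^ (t - u) * ⟪y⟫ ^ (-s - v)) := by
          rw [sub_eq_add_neg t, sub_eq_add_neg (-s), Real.rpow_add hx, Real.rpow_add hy]
          ring
      _ ≤ _ := by
          gcongr
          exact le_add_of_nonneg_right (by positivity)

end RieszPotential

/-- Kernel boundedness from the proof of Lemma 3.15: the integral operator with kernel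
`|x - y|^(J+1-N)` is bounded from `L²_s(ℝ^N)` to `L²_t(ℝ^N)` for `s > J - 1/2` and
`t < min{s, N/2} - J - 1`. -/
theorem kernel_boundedness_weighted_L2
    (N : ℕ) (hN3 : 3 ≤ N) (hNodd : Odd N) (J : ℕ) (hJ : 1 ≤ J)
    (s t : ℝ) (hs : (J : ℝ) - 1 / 2 < s) (ht : t < min s ((N : ℝ) / 2) - J - 1) :
    ∃ C : ℝ, 0 < C ∧
      ∀ f : EuclideanSpace ℝ (Fin N) → ℂ, Measurable f →
        Integrable (fun y => (1 + ‖y‖ ^ 2) ^ s * ‖f y‖ ^ 2) →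
        (∀ᵐ x : EuclideanSpace ℝ (Fin N),
            Integrable (fun y => ‖x - y‖ ^ ((J : ℝ) + 1 - (N : ℝ)) • f y)) ∧
          (∫ x : EuclideanSpace ℝ (Fin N),
              (1 + ‖x‖ ^ 2) ^ t *
                ‖∫ y : EuclideanSpace ℝ (Fin N),
                    ‖x - y‖ ^ ((J : ℝ) + 1 - (N : ℝ)) • f y‖ ^ 2)
            ≤ C ^ 2 * ∫ y : EuclideanSpace ℝ (Fin N), (1 + ‖y‖ ^ 2) ^ s * ‖f y‖ ^ 2 := by
  have hN : (3 : ℝ) ≤ N := by exact_mod_cast hN3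
  have : Nontrivial (EuclideanSpace ℝ (Fin N)) :=
    Module.nontrivial_of_finrank_pos (R := ℝ) (by simp; omega)
  obtain ⟨D, hD⟩ := isL2BoundedKernel_weighted_riesz
    (volume : Measure (EuclideanSpace ℝ (Fin N))) (α := (J : ℝ) + 1) (s := s) (t := t)
    (by positivity) (by rw [finrank_euclideanSpace_fin]; linarith)
    (by rw [finrank_euclideanSpace_fin]; linarith)
  rw [finrank_euclideanSpace_fin] at hD
  set γ : ℝ := (J : ℝ) + 1 - N
  refine ⟨√(D + 1), by positivity, fun f hf hfi => ?_⟩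
  rw [Real.sq_sqrt (by positivity)]
  set M : ℝ := ∫ y : EuclideanSpace ℝ (Fin N), (1 + ‖y‖ ^ 2) ^ s * ‖f y‖ ^ 2 with hM
  have hM0 : 0 ≤ M := integral_nonneg fun y => by positivity
  set F : EuclideanSpace ℝ (Fin N) → ℝ≥0∞ := fun x => ∫⁻ y, ‖‖x - y‖ ^ γ • f y‖ₑ
  have hFm : Measurable F :=
    Measurable.lintegral_prod_right'
      (f := fun p : EuclideanSpace ℝ (Fin N) × EuclideanSpace ℝ (Fin N) =>
        ‖‖p.1 - p.2‖ ^ γ • f p.2‖ₑ) (by fun_prop)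
  have hbound : ∫⁻ x, ENNReal.ofReal ((1 + ‖x‖ ^ 2) ^ t) * F x ^ 2 ≤ ENNReal.ofReal (D * M) := by
    have h := hD (fun y => ENNReal.ofReal (japaneseBracket y ^ s * ‖f y‖)) (by fun_prop)
    have hw (x : EuclideanSpace ℝ (Fin N)) := japaneseBracket_pos x
    have hR : ∫⁻ y, ENNReal.ofReal (japaneseBracket y ^ s * ‖f y‖) ^ 2 = ENNReal.ofReal M := by
      rw [hM, ofReal_integral_eq_lintegral_ofReal hfi (.of_forall fun y => by positivity)]
      refine lintegral_congr fun y => ?_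
      have := hw y
      rw [← ENNReal.ofReal_pow (by positivity), mul_pow, japaneseBracket_rpow_sq]
    rw [hR] at h
    rw [ENNReal.ofReal_mul D.coe_nonneg, ENNReal.ofReal_coe_nnreal]
    refine le_trans (lintegral_mono fun x => le_of_eq ?_) h
    have hx := hw x
    have hin : ∀ y, ENNReal.ofReal (japaneseBracket x ^ t * ‖x - y‖ ^ γ * japaneseBracket y ^ (-s))
        * ENNReal.ofReal (japaneseBracket y ^ s * ‖f y‖) =
        ENNReal.ofReal (japaneseBracket x ^ t) * ‖‖x - y‖ ^ γ • f y‖ₑ := by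
      intro y
      have hy := hw y
      rw [← ofReal_norm, ← ENNReal.ofReal_mul (by positivity), ← ENNReal.ofReal_mul (by positivity),
        norm_smul, Real.norm_of_nonneg (by positivity), Real.rpow_neg hy.le]
      congr 1
      field_simp
    simp only [hin]
    rw [lintegral_const_mul' _ _ (by simp), mul_pow, ← ENNReal.ofReal_pow (by positivity),
      japaneseBracket_rpow_sq]
  have hfin : ∀ᵐ x, F x < ∞ := by
    filter_upwards [ae_lt_top (by fun_prop) (hbound.trans_lt ENNReal.ofReal_lt_top).ne] with x hx
    by_contra h
    have hpos : 0 < (1 + ‖x‖ ^ 2) ^ t := by positivity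
    rw [not_lt_top_iff.1 h] at hx
    simp [hpos] at hx
  refine ⟨?_, ?_⟩
  · filter_upwards [hfin] with x hx
    exact ⟨Measurable.aestronglyMeasurable (by fun_prop), hx⟩
  · calc _ ≤ ‖∫ x : EuclideanSpace ℝ (Fin N), (1 + ‖x‖ ^ 2) ^ t *
            ‖∫ y : EuclideanSpace ℝ (Fin N), ‖x - y‖ ^ γ • f y‖ ^ 2‖ := Real.le_norm_self _
      _ ≤ D * M := by
          refine (norm_integral_le_lintegral_norm _).trans
            (ENNReal.toReal_le_of_le_ofReal (by positivity) (le_trans ?_ hbound))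
          refine lintegral_mono fun x => ?_
          rw [Real.norm_of_nonneg (by positivity), ENNReal.ofReal_mul (by positivity),
            ENNReal.ofReal_pow (by positivity), ofReal_norm]
          gcongr
          exact enorm_integral_le_lintegral_enorm _
      _ ≤ (D + 1) * M := by gcongr; linarith
end
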